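/- arXiv:0903.0641 — 2 statements merged into one kernel-verified Lean document; each statement's English description precedes it below -/
import Mathlib

section
/- The algebra S_n is a prime ring, its center equals K·1 (i.e. S_n is a central K-algebra), and every nonzero two-sided ideal of S_n is an essential submodule of S_n both as a left S_n-module and as a right S_n-module. -/
set_option synthInstance.maxHeartbeats 1000000
set_option maxHeartbeats 1000000

open MvPolynomial

noncomputable section

/-- The polynomial algebra `P_n = K[x_1, …, x_n]`. -/
abbrev PolyAlg (K : Type u) [Field K] (n : ℕ) := MvPolynomial (Fin n) K

/-- `X_i` : multiplication by the variable `x_i`, as a `K`-linear endomorphism of `P_n`. -/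
def Xop (K : Type u) [Field K] (n : ℕ) (i : Fin n) : Module.End K (PolyAlg K n) :=
  LinearMap.mulLeft K (X i)

/-- `Y_i` : the left inverse of `X_i`, sending a monomial `x^α` to `x^{α - e_i}` if `α i ≥ 1`
and to `0` otherwise. -/
def Yop (K : Type u) [Field K] (n : ℕ) (i : Fin n) : Module.End K (PolyAlg K n) :=
  (basisMonomials (Fin n) K).constr K fun α =>
    if α i = 0 then 0 else monomial (α - Finsupp.single i 1) (1 : K)

/-- The algebra `S_n` of one-sided inverses of `P_n` : the subalgebra of `End_K(P_n)`
generated by `X_1, …, X_n, Y_1, …, Y_n`. -/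
def SnAlg (K : Type u) [Field K] (n : ℕ) : Subalgebra K (Module.End K (PolyAlg K n)) :=
  Algebra.adjoin K (Set.range (Xop K n) ∪ Set.range (Yop K n))

/-- `x_i` as an element of `S_n`. -/
def xS (K : Type u) [Field K] (n : ℕ) (i : Fin n) : SnAlg K n :=
  ⟨Xop K n i, Algebra.subset_adjoin (Set.mem_union_left _ ⟨i, rfl⟩)⟩

/-- `y_i` as an element of `S_n`. -/
def yS (K : Type u) [Field K] (n : ℕ) (i : Fin n) : SnAlg K n :=
  ⟨Yop K n i, Algebra.subset_adjoin (Set.mem_union_right _ ⟨i, rfl⟩)⟩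

/-- The product `I*J` of two two-sided ideals: the two-sided ideal generated by all products
`a * b` with `a ∈ I`, `b ∈ J`. -/
def tsiMul {R : Type*} [Ring R] (I J : TwoSidedIdeal R) : TwoSidedIdeal R :=
  TwoSidedIdeal.span {x | ∃ a ∈ I, ∃ b ∈ J, x = a * b}

/-- A two-sided ideal `P` of a ring is prime if it is proper and for all two-sided ideals
`I`, `J`, `I*J ⊆ P` implies `I ⊆ P` or `J ⊆ P`. -/
def tsiPrime {R : Type*} [Ring R] (P : TwoSidedIdeal R) : Prop :=
  P ≠ ⊤ ∧ ∀ I J : TwoSidedIdeal R, tsiMul I J ≤ P → I ≤ P ∨ J ≤ P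

/-- The matrix unit `E_{αβ}` : it sends `x^β` to `x^α` and kills all other monomials. -/
def matUnit (K : Type u) [Field K] (n : ℕ) (α β : Fin n →₀ ℕ) : Module.End K (PolyAlg K n) :=
  monomial α ∘ₗ lcoeff K β

theorem matUnit_apply {K : Type u} [Field K] {n : ℕ} (α β : Fin n →₀ ℕ) (p : PolyAlg K n) :
    matUnit K n α β p = monomial α (coeff β p) := rfl

theorem Yop_monomial {K : Type u} [Field K] {n : ℕ} (i : Fin n) (α : Fin n →₀ ℕ) :
    Yop K n i (monomial α 1) =
      if α i = 0 then 0 else monomial (α - Finsupp.single i 1) (1 : K) := by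
  have h := (basisMonomials (Fin n) K).constr_basis K
    (fun α => if α i = 0 then 0 else monomial (α - Finsupp.single i 1) (1 : K)) α
  rwa [coe_basisMonomials] at h

theorem Xop_monomial {K : Type u} [Field K] {n : ℕ} (i : Fin n) (α : Fin n →₀ ℕ) (c : K) :
    Xop K n i (monomial α c) = monomial (α + Finsupp.single i 1) c := by
  rw [Xop, LinearMap.mulLeft_apply, X, monomial_mul, one_mul, add_comm]

theorem Xop_mem (K : Type u) [Field K] (n : ℕ) (i : Fin n) : Xop K n i ∈ SnAlg K n :=
  (xS K n i).2

theorem Yop_mem (K : Type u) [Field K] (n : ℕ) (i : Fin n) : Yop K n i ∈ SnAlg K n :=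
  (yS K n i).2

theorem Xop_mul_matUnit {K : Type u} [Field K] {n : ℕ} (i : Fin n) (α β : Fin n →₀ ℕ) :
    Xop K n i * matUnit K n α β = matUnit K n (α + Finsupp.single i 1) β := by
  refine LinearMap.ext fun p => ?_
  rw [Module.End.mul_apply, matUnit_apply, matUnit_apply, Xop_monomial]

theorem matUnit_mul_Yop {K : Type u} [Field K] {n : ℕ} (i : Fin n) (α β : Fin n →₀ ℕ) :
    matUnit K n α β * Yop K n i = matUnit K n α (β + Finsupp.single i 1) := by
  refine (basisMonomials (Fin n) K).ext fun γ => ?_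
  rw [coe_basisMonomials, Module.End.mul_apply, Yop_monomial, matUnit_apply, matUnit_apply]
  by_cases h : γ i = 0
  · have : γ ≠ β + Finsupp.single i 1 := by
      rintro rfl
      simp at h
    simp [h, coeff_monomial, this]
  · have hle : Finsupp.single i 1 ≤ γ := by
      simpa [Finsupp.single_le_iff] using Nat.one_le_iff_ne_zero.mpr h
    have : γ - Finsupp.single i 1 = β ↔ γ = β + Finsupp.single i 1 :=
      tsub_eq_iff_eq_add_of_le hle
    simp [h, coeff_monomial, this]

/-- The projection onto the span of the monomials not involving the variables in `s` lies
in `S_n`. -/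
theorem exists_mem_SnAlg_projection (K : Type u) [Field K] (n : ℕ) (s : Finset (Fin n)) :
    ∃ P ∈ SnAlg K n, ∀ γ : Fin n →₀ ℕ,
      P (monomial γ 1) = if ∀ i ∈ s, γ i = 0 then monomial γ 1 else 0 := by
  induction s using Finset.induction_on with
  | empty => exact ⟨1, one_mem _, fun γ => by simp⟩
  | insert i s _ ih =>
    obtain ⟨P, hP, hγ⟩ := ih
    refine ⟨(1 - Xop K n i * Yop K n i) * P,
      mul_mem (sub_mem (one_mem _) (mul_mem (Xop_mem K n i) (Yop_mem K n i))) hP, fun γ => ?_⟩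
    rw [Module.End.mul_apply, hγ]
    by_cases hs : ∀ j ∈ s, γ j = 0
    · rw [if_pos hs, LinearMap.sub_apply, Module.End.mul_apply, Yop_monomial]
      by_cases h : γ i = 0
      · have : ∀ j ∈ insert i s, γ j = 0 := by simpa [h] using hs
        simp [h, if_pos hs]
      · have hle : Finsupp.single i 1 ≤ γ := by
          simpa [Finsupp.single_le_iff] using Nat.one_le_iff_ne_zero.mpr h
        simp [h, Xop_monomial, tsub_add_cancel_of_le hle]
    · have : ¬ ∀ j ∈ insert i s, γ j = 0 := fun H => hs fun j hj => H j (by simp [hj])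
      rw [if_neg hs, if_neg this, map_zero]

theorem matUnit_mem (K : Type u) [Field K] (n : ℕ) (α β : Fin n →₀ ℕ) :
    matUnit K n α β ∈ SnAlg K n := by
  have h0 : matUnit K n 0 0 ∈ SnAlg K n := by
    obtain ⟨P, hP, hγ⟩ := exists_mem_SnAlg_projection K n Finset.univ
    convert hP
    refine (basisMonomials (Fin n) K).ext fun γ => ?_
    rw [coe_basisMonomials, hγ, matUnit_apply, coeff_monomial]
    have : (∀ i ∈ Finset.univ, γ i = 0) ↔ γ = 0 := by simp [Finsupp.ext_iff]
    simp only [this]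
    by_cases h : γ = 0 <;> simp [h]
  have hX : ∀ α γ : Fin n →₀ ℕ, matUnit K n γ 0 ∈ SnAlg K n →
      matUnit K n (γ + α) 0 ∈ SnAlg K n := by
    intro α
    induction α using Finsupp.induction_linear with
    | zero => simp
    | add f g hf hg => exact fun γ h => by simpa [add_assoc] using hg _ (hf γ h)
    | single i k =>
      intro γ h
      induction k with
      | zero => simpa using h
      | succ k ih =>
        rw [Finsupp.single_add, ← add_assoc, ← Xop_mul_matUnit]
        exact mul_mem (Xop_mem K n i) ih
  have hY : ∀ β γ : Fin n →₀ ℕ, matUnit K n α γ ∈ SnAlg K n →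
      matUnit K n α (γ + β) ∈ SnAlg K n := by
    intro β
    induction β using Finsupp.induction_linear with
    | zero => simp
    | add f g hf hg => exact fun γ h => by simpa [add_assoc] using hg _ (hf γ h)
    | single i k =>
      intro γ h
      induction k with
      | zero => simpa using h
      | succ k ih =>
        rw [Finsupp.single_add, ← add_assoc, ← matUnit_mul_Yop]
        exact mul_mem ih (Yop_mem K n i)
  simpa using hY β 0 (by simpa using hX α 0 h0)

/-- The matrix unit `E_{αβ}` as an element of `S_n`. -/
def matUnitS (K : Type u) [Field K] (n : ℕ) (α β : Fin n →₀ ℕ) : SnAlg K n :=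
  ⟨matUnit K n α β, matUnit_mem K n α β⟩

theorem matUnitS_ne_zero {K : Type u} [Field K] {n : ℕ} (α β : Fin n →₀ ℕ) :
    matUnitS K n α β ≠ 0 := by
  intro h
  have := LinearMap.congr_fun (congrArg Subtype.val h) (monomial β 1)
  simp [matUnitS, matUnit_apply] at this

/-- A nonzero element of `S_n` has a nonzero matrix coefficient. -/
theorem exists_matUnitS_mul_mul {K : Type u} [Field K] {n : ℕ} {a : SnAlg K n} (ha : a ≠ 0) :
    ∃ α β : Fin n →₀ ℕ, ∃ c : K, c ≠ 0 ∧ ∀ γ δ : Fin n →₀ ℕ,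
      matUnitS K n γ α * a * matUnitS K n β δ = c • matUnitS K n γ δ := by
  have : ∃ β, a.1 (monomial β 1) ≠ 0 := by
    by_contra! h
    refine ha (Subtype.ext ((basisMonomials (Fin n) K).ext fun γ => ?_))
    rw [coe_basisMonomials, h]
    rfl
  obtain ⟨β, hβ⟩ := this
  obtain ⟨α, hα⟩ := ne_zero_iff.mp hβ
  refine ⟨α, β, _, hα, fun γ δ => Subtype.ext (LinearMap.ext fun p => ?_)⟩
  change monomial γ (coeff α (a.1 (monomial β (coeff δ p)))) =
    coeff α (a.1 (monomial β 1)) • monomial γ (coeff δ p)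
  have : monomial β (coeff δ p) = coeff δ p • (monomial β 1 : PolyAlg K n) := by
    simp [smul_monomial]
  rw [this, map_smul, coeff_smul, smul_monomial, smul_eq_mul, smul_eq_mul, mul_comm]

theorem matUnitS_mem_of_ne_bot {K : Type u} [Field K] {n : ℕ} {I : TwoSidedIdeal (SnAlg K n)}
    (hI : I ≠ ⊥) (γ δ : Fin n →₀ ℕ) : matUnitS K n γ δ ∈ I := by
  have : ∃ a ∈ I, a ≠ 0 := by
    by_contra! h
    exact hI (le_bot_iff.mp fun a ha => (TwoSidedIdeal.mem_bot _).mpr (h a ha))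
  obtain ⟨a, haI, ha⟩ := this
  obtain ⟨α, β, c, hc, h⟩ := exists_matUnitS_mul_mul ha
  have key := I.mul_mem_left (algebraMap K _ c⁻¹) _
    (I.mul_mem_right _ (matUnitS K n β δ) (I.mul_mem_left (matUnitS K n γ α) _ haI))
  rwa [h, ← Algebra.smul_def, smul_smul, inv_mul_cancel₀ hc, one_smul] at key

theorem matUnitS_mul_matUnitS {K : Type u} [Field K] {n : ℕ} (α β γ : Fin n →₀ ℕ) :
    matUnitS K n α β * matUnitS K n β γ = matUnitS K n α γ := by
  refine Subtype.ext (LinearMap.ext fun p => ?_)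
  change monomial α (coeff β (monomial β (coeff γ p))) = monomial α (coeff γ p)
  simp

/-- `S_n` is a prime ring, it is central (its center is `K·1`), and every nonzero
two-sided ideal of `S_n` is an essential left and an essential right submodule of `S_n`. -/
theorem statement0 (K : Type u) [Field K] (n : ℕ) (hn : 0 < n) :
    tsiPrime (⊥ : TwoSidedIdeal (SnAlg K n)) ∧
    Set.range (algebraMap K (SnAlg K n)) = {z : SnAlg K n | ∀ w, z * w = w * z} ∧
    ∀ I : TwoSidedIdeal (SnAlg K n), I ≠ ⊥ →
      (∀ N : Submodule (SnAlg K n) (SnAlg K n), N ≠ ⊥ →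
        ∃ x : SnAlg K n, x ∈ N ∧ x ∈ I ∧ x ≠ 0) ∧
      (∀ N : Submodule (SnAlg K n)ᵐᵒᵖ (SnAlg K n), N ≠ ⊥ →
        ∃ x : SnAlg K n, x ∈ N ∧ x ∈ I ∧ x ≠ 0) := by
  refine ⟨⟨fun h => ?_, fun I J hIJ => ?_⟩, ?_, fun I hI => ⟨fun N hN => ?_, fun N hN => ?_⟩⟩
  · have : matUnitS K n 0 0 ∈ (⊥ : TwoSidedIdeal (SnAlg K n)) := h ▸ trivial
    exact matUnitS_ne_zero _ _ ((TwoSidedIdeal.mem_bot _).mp this)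
  · by_contra! h
    have hI : I ≠ ⊥ := fun e => h.1 e.le
    have hJ : J ≠ ⊥ := fun e => h.2 e.le
    have : matUnitS K n 0 0 ∈ tsiMul I J := TwoSidedIdeal.subset_span
      ⟨_, matUnitS_mem_of_ne_bot hI 0 0, _, matUnitS_mem_of_ne_bot hJ 0 0,
        (matUnitS_mul_matUnitS 0 0 0).symm⟩
    exact matUnitS_ne_zero _ _ ((TwoSidedIdeal.mem_bot _).mp (hIJ this))
  · ext z
    refine ⟨?_, fun hz => ⟨coeff 0 (z.1 (monomial 0 1)), ?_⟩⟩
    · rintro ⟨c, rfl⟩ w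
      exact Algebra.commutes c w
    · refine Subtype.ext ((basisMonomials (Fin n) K).ext fun γ => ?_)
      have h := LinearMap.congr_fun (congrArg Subtype.val (hz (matUnitS K n γ 0))) (monomial 0 1)
      change z.1 (monomial γ (coeff 0 (monomial 0 1))) =
        monomial γ (coeff 0 (z.1 (monomial 0 1))) at h
      rw [coeff_monomial, if_pos rfl] at h
      rw [coe_basisMonomials, h]
      change coeff 0 (z.1 (monomial 0 1)) • monomial γ (1 : K) = _
      rw [smul_monomial, smul_eq_mul, mul_one]
  · obtain ⟨a, haN, ha⟩ := N.ne_bot_iff.mp hN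
    obtain ⟨α, β, c, hc, h⟩ := exists_matUnitS_mul_mul ha
    refine ⟨matUnitS K n 0 α * a, N.smul_mem _ haN,
      I.mul_mem_right _ _ (matUnitS_mem_of_ne_bot hI 0 α), fun h0 => ?_⟩
    have := h 0 0
    rw [h0, zero_mul] at this
    exact smul_ne_zero hc (matUnitS_ne_zero _ _) this.symm
  · obtain ⟨a, haN, ha⟩ := N.ne_bot_iff.mp hN
    obtain ⟨α, β, c, hc, h⟩ := exists_matUnitS_mul_mul ha
    refine ⟨a * matUnitS K n β 0, N.smul_mem (MulOpposite.op (matUnitS K n β 0)) haN,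
      I.mul_mem_left _ _ (matUnitS_mem_of_ne_bot hI β 0), fun h0 => ?_⟩
    have := h 0 0
    rw [mul_assoc, h0, mul_zero] at this
    exact smul_ne_zero hc (matUnitS_ne_zero _ _) this.symm
end
end

section
/- The classical Krull dimension of the algebra S_n is 2n: there exists a chain of prime two-sided ideals of S_n of length 2n, and every chain of prime two-sided ideals of S_n has length at most 2n. -/
set_option synthInstance.maxHeartbeats 1000000
set_option maxHeartbeats 1000000

open MvPolynomial

noncomputable section

namespace SnAlg

variable {K : Type*} [Field K] {n : ℕ}

/-- The embedding of `P_n` in `S_n` by multiplication operators. -/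
def phi (K : Type*) [Field K] (n : ℕ) : PolyAlg K n →ₐ[K] SnAlg K n :=
  (Algebra.lmul K (PolyAlg K n)).codRestrict (SnAlg K n) fun f => by
    induction f using MvPolynomial.induction_on with
    | C a => rw [← MvPolynomial.algebraMap_eq, AlgHom.commutes]; exact Subalgebra.algebraMap_mem _ _
    | add p q hp hq => rw [map_add]; exact add_mem hp hq
    | mul_X p i hp => rw [map_mul]; exact mul_mem hp (xS K n i).2

@[simp]
lemma phi_apply (f g : PolyAlg K n) : (phi K n f).1 g = f * g := rfl

@[simp]
lemma phi_X (i : Fin n) : phi K n (X i) = xS K n i := rfl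

@[simp]
lemma mul_apply (a b : SnAlg K n) (f : PolyAlg K n) : (a * b).1 f = a.1 (b.1 f) := rfl

@[simp]
lemma one_apply (f : PolyAlg K n) : (1 : SnAlg K n).1 f = f := rfl

@[simp]
lemma sub_apply (a b : SnAlg K n) (f : PolyAlg K n) : (a - b).1 f = a.1 f - b.1 f := rfl

@[simp]
lemma add_apply (a b : SnAlg K n) (f : PolyAlg K n) : (a + b).1 f = a.1 f + b.1 f := rfl

@[simp]
lemma zero_apply (f : PolyAlg K n) : (0 : SnAlg K n).1 f = 0 := rfl

@[simp]
lemma xS_apply (i : Fin n) (f : PolyAlg K n) : (xS K n i).1 f = X i * f := rfl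

@[ext]
lemma ext' {a b : SnAlg K n} (h : ∀ f, a.1 f = b.1 f) : a = b :=
  Subtype.ext (LinearMap.ext h)

/-- Division by the monomial with exponent `γ`, discarding the terms not divisible by it. -/
def divOp (K : Type*) [Field K] {n : ℕ} (γ : Fin n →₀ ℕ) : Module.End K (PolyAlg K n) where
  toFun f := f.divMonomial γ
  map_add' f g := add_divMonomial f g γ
  map_smul' c f := by ext; simp

lemma coeff_divOp (γ δ : Fin n →₀ ℕ) (f : PolyAlg K n) :
    coeff δ (divOp K γ f) = coeff (γ + δ) f := rfl

lemma divOp_single (i : Fin n) : divOp K (Finsupp.single i 1) = Yop K n i := by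
  refine (basisMonomials (Fin n) K).ext fun α => ?_
  rw [Yop, Module.Basis.constr_basis]
  ext δ
  rw [coeff_divOp, coe_basisMonomials]
  by_cases h : α i = 0
  · rw [if_pos h, coeff_monomial, if_neg, coeff_zero]
    rintro rfl
    simp at h
  · rw [if_neg h, coeff_monomial, coeff_monomial]
    congr 1
    have : Finsupp.single i 1 ≤ α := by simpa [Nat.one_le_iff_ne_zero] using h
    rw [eq_iff_iff, tsub_eq_iff_eq_add_of_le this, add_comm]

lemma divOp_zero : divOp K (0 : Fin n →₀ ℕ) = 1 := by
  refine LinearMap.ext fun f => ?_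
  ext δ
  simp [coeff_divOp]

lemma divOp_add (α β : Fin n →₀ ℕ) : divOp K (α + β) = divOp K α * divOp K β := by
  refine LinearMap.ext fun f => ?_
  ext δ
  rw [Module.End.mul_apply, coeff_divOp, coeff_divOp, coeff_divOp, add_left_comm, add_assoc]

/-- The element `y^γ` of `S_n`. -/
def yPow (K : Type*) [Field K] {n : ℕ} (γ : Fin n →₀ ℕ) : SnAlg K n :=
  ⟨divOp K γ, by
    classical
    induction γ using Finsupp.induction_linear with
    | zero => rw [divOp_zero]; exact one_mem _
    | add f g hf hg => rw [divOp_add]; exact mul_mem hf hg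
    | single i k =>
      induction k with
      | zero => rw [Finsupp.single_zero, divOp_zero]; exact one_mem _
      | succ k ih =>
        rw [Finsupp.single_add, divOp_add, divOp_single]
        exact mul_mem ih (yS K n i).2⟩

lemma coeff_yPow (γ δ : Fin n →₀ ℕ) (f : PolyAlg K n) :
    coeff δ ((yPow K γ).1 f) = coeff (γ + δ) f := rfl

lemma yPow_single (i : Fin n) : yPow K (Finsupp.single i 1) = yS K n i :=
  Subtype.ext (divOp_single i)

lemma yPow_zero : yPow K (0 : Fin n →₀ ℕ) = 1 := Subtype.ext divOp_zero

lemma yPow_add (α β : Fin n →₀ ℕ) : yPow K (α + β) = yPow K α * yPow K β :=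
  Subtype.ext (divOp_add α β)

lemma coeff_yS (i : Fin n) (δ : Fin n →₀ ℕ) (f : PolyAlg K n) :
    coeff δ ((yS K n i).1 f) = coeff (Finsupp.single i 1 + δ) f := by
  rw [← yPow_single, coeff_yPow]

@[simp]
lemma yS_mul_xS (i : Fin n) : yS K n i * xS K n i = 1 := by
  ext f δ
  simp [coeff_yS]

@[simp]
lemma yS_X_mul (i : Fin n) (f : PolyAlg K n) : (yS K n i).1 (X i * f) = f := by
  rw [← xS_apply, ← mul_apply, yS_mul_xS, one_apply]

lemma yPow_X_mul {γ : Fin n →₀ ℕ} {i : Fin n} (h : γ i = 0) (f : PolyAlg K n) :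
    (yPow K γ).1 (X i * f) = X i * (yPow K γ).1 f := by
  ext δ
  rw [coeff_yPow, coeff_X_mul', coeff_X_mul']
  have h1 : i ∈ (γ + δ).support ↔ i ∈ δ.support := by simp [h]
  rw [if_congr h1 rfl rfl]
  split_ifs with hi
  · rw [coeff_yPow]
    congr 1
    ext j
    rcases eq_or_ne i j with rfl | hj
    · simp [h]
    · simp [Finsupp.single_eq_of_ne hj.symm]
  · rfl

lemma yPow_mul_of_mem_supported {γ : Fin n →₀ ℕ} {s : Set (Fin n)} (hs : ∀ i ∈ s, γ i = 0)
    {h : PolyAlg K n} (hh : h ∈ supported K s) (f : PolyAlg K n) :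
    (yPow K γ).1 (h * f) = h * (yPow K γ).1 f := by
  rw [supported_eq_adjoin_X] at hh
  induction hh using Algebra.adjoin_induction generalizing f with
  | mem x hx => obtain ⟨i, hi, rfl⟩ := hx; exact yPow_X_mul (hs i hi) f
  | algebraMap r => rw [← Algebra.smul_def, ← Algebra.smul_def, map_smul]
  | add x y _ _ hx hy => simp [add_mul, hx, hy]
  | mul x y _ _ hx hy => rw [mul_assoc, hx, hy, mul_assoc]

lemma yS_mul_of_mem_supported {j : Fin n} {s : Set (Fin n)} (hs : j ∉ s)
    {h : PolyAlg K n} (hh : h ∈ supported K s) (f : PolyAlg K n) :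
    (yS K n j).1 (h * f) = h * (yS K n j).1 f := by
  rw [← yPow_single]
  refine yPow_mul_of_mem_supported (fun i hi => ?_) hh f
  rw [Finsupp.single_apply, if_neg]
  rintro rfl
  exact hs hi

lemma yS_X_mul_of_ne {i j : Fin n} (h : i ≠ j) (f : PolyAlg K n) :
    (yS K n j).1 (X i * f) = X i * (yS K n j).1 f :=
  yS_mul_of_mem_supported (s := {i}) (by simpa using h.symm) (X_mem_supported.2 rfl) f

lemma yS_one (j : Fin n) : (yS K n j).1 1 = 0 := by
  ext δ
  rw [coeff_yS, coeff_one, if_neg, coeff_zero]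
  intro h
  have := DFunLike.congr_fun h j
  simp at this
  lia

lemma yS_eq_zero_of_mem_supported {j : Fin n} {s : Set (Fin n)} (hs : j ∉ s)
    {h : PolyAlg K n} (hh : h ∈ supported K s) : (yS K n j).1 h = 0 := by
  rw [← mul_one h, yS_mul_of_mem_supported hs hh, yS_one, mul_zero]

/-- To prove a property of all elements of `S_n` it suffices to check that it is linear, holds
for `1` and is stable under left multiplication by the generators. -/
lemma left_induction {p : SnAlg K n → Prop} (one : p 1) (add : ∀ a b, p a → p b → p (a + b))
    (smul : ∀ (c : K) a, p a → p (c • a)) (x_mul : ∀ i a, p a → p (xS K n i * a))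
    (y_mul : ∀ i a, p a → p (yS K n i * a)) (a : SnAlg K n) : p a := by
  suffices H : ∀ b, p b → p (a * b) by simpa using H 1 one
  obtain ⟨a, ha⟩ := a
  refine Algebra.adjoin_induction
    (p := fun x hx => ∀ b : SnAlg K n, p b → p (⟨x, hx⟩ * b)) ?_ ?_ ?_ ?_ ha
  · rintro _ (⟨i, rfl⟩ | ⟨i, rfl⟩) b hb
    exacts [x_mul i b hb, y_mul i b hb]
  · intro r b hb
    have : (algebraMap K (SnAlg K n) r) * b = r • b := (Algebra.smul_def r b).symm
    exact this ▸ smul r b hb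
  · intro x y hx hy h1 h2 b hb
    have := add _ _ (h1 b hb) (h2 b hb)
    rwa [← add_mul] at this
  · intro x y hx hy h1 h2 b hb
    have := h1 _ (h2 b hb)
    rwa [← mul_assoc] at this

/-- The substitution `x_j ↦ 0` for `j ∈ J`. -/
def kill (K : Type*) [Field K] {n : ℕ} (J : Finset (Fin n)) : PolyAlg K n →ₐ[K] PolyAlg K n :=
  aeval fun i => if i ∈ J then 0 else X i

lemma kill_X_of_mem {J : Finset (Fin n)} {j : Fin n} (h : j ∈ J) : kill K J (X j) = 0 := by
  simp [kill, h]

lemma kill_X_of_notMem {J : Finset (Fin n)} {j : Fin n} (h : j ∉ J) :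
    kill K J (X j) = X j := by
  simp [kill, h]

lemma kill_mem_supported (J : Finset (Fin n)) (f : PolyAlg K n) :
    kill K J f ∈ supported K (↑Jᶜ : Set (Fin n)) := by
  induction f using MvPolynomial.induction_on with
  | C a => rw [kill, aeval_C]; exact Subalgebra.algebraMap_mem _ _
  | add p q hp hq => rw [map_add]; exact add_mem hp hq
  | mul_X p i hp =>
    rw [map_mul]
    refine mul_mem hp ?_
    by_cases h : i ∈ J
    · rw [kill_X_of_mem h]; exact zero_mem _
    · rw [kill_X_of_notMem h]; exact X_mem_supported.2 (by simpa using h)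

lemma kill_of_mem_supported {J : Finset (Fin n)} {h : PolyAlg K n}
    (hh : h ∈ supported K (↑Jᶜ : Set (Fin n))) : kill K J h = h := by
  rw [supported_eq_adjoin_X] at hh
  induction hh using Algebra.adjoin_induction with
  | mem x hx => obtain ⟨i, hi, rfl⟩ := hx; exact kill_X_of_notMem (by simpa using hi)
  | algebraMap r => exact AlgHom.commutes _ _
  | add x y _ _ hx hy => rw [map_add, hx, hy]
  | mul x y _ _ hx hy => rw [map_mul, hx, hy]

lemma kill_singleton_eq (j : Fin n) (f : PolyAlg K n) :
    kill K {j} f = f - X j * (yS K n j).1 f := by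
  induction f using MvPolynomial.induction_on with
  | C a =>
    rw [← mul_one (C a), ← smul_eq_C_mul, map_smul, map_smul, yS_one, map_one, smul_zero, mul_zero,
      sub_zero]
  | add p q hp hq => rw [map_add, map_add, hp, hq]; ring
  | mul_X p i hp =>
    rw [map_mul, mul_comm p]
    rcases eq_or_ne i j with rfl | h
    · rw [yS_X_mul, kill_X_of_mem (by simp), mul_zero, sub_self]
    · rw [yS_X_mul_of_ne h, kill_X_of_notMem (by simpa using h), hp]; ring

lemma kill_insert (j : Fin n) (J : Finset (Fin n)) (f : PolyAlg K n) :
    kill K (insert j J) f = kill K {j} (kill K J f) := by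
  rw [← AlgHom.comp_apply]
  congr 1
  ext1 i
  by_cases h : i ∈ J
  · simp [kill, h]
  · simp [kill, h]

/-- The idempotent `e_J = ∏_{j ∈ J} (1 - x_j y_j)` of `S_n`, acting as the substitution `x_j ↦ 0`
for `j ∈ J`. -/
def eS (K : Type*) [Field K] {n : ℕ} (J : Finset (Fin n)) : SnAlg K n :=
  ⟨(kill K J).toLinearMap, by
    induction J using Finset.induction_on with
    | empty =>
      have : (kill K (∅ : Finset (Fin n))).toLinearMap = 1 :=
        LinearMap.ext fun f => kill_of_mem_supported (by simp)
      rw [this]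
      exact one_mem _
    | insert j J _ ih =>
      have : (kill K (insert j J)).toLinearMap =
          (1 - xS K n j * yS K n j : SnAlg K n).1 * (kill K J).toLinearMap :=
        LinearMap.ext fun f => (kill_insert j J f).trans (kill_singleton_eq j _)
      rw [this]
      exact mul_mem (Subtype.property _) ih⟩

@[simp]
lemma eS_apply (J : Finset (Fin n)) (f : PolyAlg K n) : (eS K J).1 f = kill K J f := rfl

lemma eS_empty : eS K (∅ : Finset (Fin n)) = 1 := by
  ext1 f
  exact kill_of_mem_supported (by simp)

lemma eS_insert (j : Fin n) (J : Finset (Fin n)) : eS K (insert j J) = eS K {j} * eS K J := by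
  ext1 f
  exact kill_insert j J f

lemma eS_singleton (j : Fin n) : eS K {j} = 1 - xS K n j * yS K n j := by
  ext1 f
  exact kill_singleton_eq j f

lemma eS_mul_xS_of_mem {J : Finset (Fin n)} {j : Fin n} (h : j ∈ J) :
    eS K J * xS K n j = 0 := by
  ext1 f
  simp [kill_X_of_mem h]

lemma xS_comm_eS {J : Finset (Fin n)} {i : Fin n} (h : i ∉ J) :
    xS K n i * eS K J = eS K J * xS K n i := by
  ext1 f
  simp [kill_X_of_notMem h]

lemma xS_comm_yS {i j : Fin n} (h : i ≠ j) : xS K n i * yS K n j = yS K n j * xS K n i := by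
  ext1 f
  simp [yS_X_mul_of_ne h]

lemma xS_comm_xS (i j : Fin n) : xS K n i * xS K n j = xS K n j * xS K n i := by
  rw [← phi_X, ← phi_X, ← map_mul, mul_comm, map_mul]

lemma yS_comm_yPow (i : Fin n) (γ : Fin n →₀ ℕ) : yS K n i * yPow K γ = yPow K γ * yS K n i := by
  rw [← yPow_single, ← yPow_add, ← yPow_add, add_comm]

lemma yS_comm_yS (i j : Fin n) : yS K n i * yS K n j = yS K n j * yS K n i := by
  rw [← yPow_single j, yS_comm_yPow]

lemma yS_comm_eS {J : Finset (Fin n)} {i : Fin n} (h : i ∉ J) :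
    yS K n i * eS K J = eS K J * yS K n i := by
  induction J using Finset.induction_on with
  | empty => rw [eS_empty, mul_one, one_mul]
  | insert j J _ ih =>
    simp only [Finset.mem_insert, not_or] at h
    have h1 : yS K n i * eS K {j} = eS K {j} * yS K n i := by
      rw [eS_singleton, mul_sub (yS K n i), sub_mul _ _ (yS K n i), mul_one, one_mul, ← mul_assoc,
        ← xS_comm_yS (Ne.symm h.1),
        mul_assoc, yS_comm_yS, mul_assoc]
    rw [eS_insert, ← mul_assoc, h1, mul_assoc, ih h.2, mul_assoc]

lemma yS_mul_eS_of_mem {J : Finset (Fin n)} {j : Fin n} (h : j ∈ J) : yS K n j * eS K J = 0 := by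
  ext1 f
  rw [mul_apply, zero_apply, eS_apply]
  exact yS_eq_zero_of_mem_supported (by simpa using h) (kill_mem_supported J f)

lemma xS_comm_yPow {γ : Fin n →₀ ℕ} {i : Fin n} (h : γ i = 0) :
    xS K n i * yPow K γ = yPow K γ * xS K n i := by
  ext1 f
  exact (yPow_X_mul h f).symm

lemma yPow_mul_xS {γ : Fin n →₀ ℕ} {i : Fin n} (h : γ i ≠ 0) :
    yPow K γ * xS K n i = yPow K (γ - Finsupp.single i 1) := by
  have : γ = (γ - Finsupp.single i 1) + Finsupp.single i 1 :=
    (tsub_add_cancel_of_le (by simpa [Nat.one_le_iff_ne_zero] using h)).symm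
  conv_lhs => rw [this, yPow_add, yPow_single, mul_assoc, yS_mul_xS, mul_one]

/-- The exponent vector in all variables obtained from one in the variables of `J`. -/
abbrev extend {J : Finset (Fin n)} (β : J →₀ ℕ) : Fin n →₀ ℕ := β.embDomain (.subtype _)

lemma extend_eq_zero {J : Finset (Fin n)} (β : J →₀ ℕ) {i : Fin n} (hi : i ∉ J) :
    extend β i = 0 :=
  Finsupp.embDomain_of_notMem_range _ _ _ (by simpa using hi)

lemma extend_apply {J : Finset (Fin n)} (β : J →₀ ℕ) (j : J) : extend β j = β j :=
  Finsupp.embDomain_apply_self _ _ _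

lemma kill_monomial_of_ne {J : Finset (Fin n)} {δ : Fin n →₀ ℕ} {j : Fin n} (hj : j ∈ J)
    (h : δ j ≠ 0) (a : K) : kill K J (monomial δ a) = 0 := by
  rw [kill, aeval_monomial, Finsupp.prod, Finset.prod_eq_zero (i := j) (by simpa using h),
    mul_zero]
  simp [hj, h]

lemma kill_yPow_monomial {J : Finset (Fin n)} (α β : J →₀ ℕ) :
    kill K J ((yPow K (extend β)).1 (monomial (extend α) 1)) = if α = β then 1 else 0 := by
  have key : ∀ δ : Fin n →₀ ℕ, (yPow K (extend β)).1 (monomial (extend α) (1 : K)) =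
      if extend β ≤ extend α then monomial (extend α - extend β) 1 else 0 := by
    intro _
    ext δ
    rw [coeff_yPow, coeff_monomial]
    split_ifs with h1 h2 h2
    · rw [h1, add_tsub_cancel_left, coeff_monomial, if_pos rfl]
    · exact absurd (h1 ▸ le_self_add) h2
    · rw [coeff_monomial, if_neg]
      rintro rfl
      exact h1 (add_tsub_cancel_of_le h2).symm
    · rfl
  rw [key 0]
  split_ifs with h1 h2 h2
  · subst h2; simp
  · have : ∃ j : J, α j ≠ β j := by
      by_contra! h; exact h2 (Finsupp.ext h)
    obtain ⟨j, hj⟩ := this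
    refine kill_monomial_of_ne j.2 ?_ 1
    have := h1 j
    rw [extend_apply, extend_apply] at this
    rw [Finsupp.tsub_apply, extend_apply, extend_apply]
    lia
  · subst h2; exact absurd le_rfl h1
  · simp

/-- `P_n` as a quotient of the polynomial algebra in the variables of `J` over the polynomial
algebra in the other variables. -/
def merge (K : Type*) [Field K] {n : ℕ} (J : Finset (Fin n)) :
    MvPolynomial J (supported K (↑Jᶜ : Set (Fin n))) →+* PolyAlg K n :=
  eval₂Hom (algebraMap _ _) fun j : J => X (j : Fin n)

lemma merge_monomial {J : Finset (Fin n)} (α : J →₀ ℕ)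
    (a : supported K (↑Jᶜ : Set (Fin n))) :
    merge K J (monomial α a) = (a : PolyAlg K n) * monomial (extend α) 1 := by
  rw [merge, coe_eval₂Hom, eval₂_monomial, monomial_eq (s := extend α), Finsupp.prod_embDomain,
    C_1, one_mul]
  rfl

lemma merge_C {J : Finset (Fin n)} (a : supported K (↑Jᶜ : Set (Fin n))) :
    merge K J (C a) = a := eval₂Hom_C _ _ _

lemma merge_surjective (J : Finset (Fin n)) : Function.Surjective (merge K J) := by
  intro f
  induction f using MvPolynomial.induction_on with
  | C a => exact ⟨C (algebraMap _ _ a), merge_C _⟩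
  | add p q hp hq =>
    obtain ⟨p, rfl⟩ := hp
    obtain ⟨q, rfl⟩ := hq
    exact ⟨p + q, map_add _ _ _⟩
  | mul_X p i hp =>
    obtain ⟨p, rfl⟩ := hp
    by_cases h : i ∈ J
    · exact ⟨p * X ⟨i, h⟩, by rw [map_mul]; congr 1; exact eval₂Hom_X' _ _ _⟩
    · exact ⟨p * C ⟨X i, X_mem_supported.2 (by simpa using h)⟩, by rw [map_mul, merge_C]⟩

lemma kill_yPow_merge_mul {J : Finset (Fin n)} (β : J →₀ ℕ)
    (F : MvPolynomial J (supported K (↑Jᶜ : Set (Fin n)))) {h : PolyAlg K n}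
    (hh : h ∈ supported K (↑Jᶜ : Set (Fin n))) :
    kill K J ((yPow K (extend β)).1 (merge K J F * h)) = (coeff β F).1 * h := by
  have h0 : ∀ i ∈ (↑Jᶜ : Set (Fin n)), extend β i = 0 := fun i hi =>
    extend_eq_zero β (by simpa using hi)
  induction F using MvPolynomial.induction_on' with
  | monomial α a =>
    rw [merge_monomial, mul_right_comm, yPow_mul_of_mem_supported h0 (mul_mem a.2 hh), map_mul,
      kill_of_mem_supported (mul_mem a.2 hh), kill_yPow_monomial, coeff_monomial]
    split_ifs <;> simp
  | add p q hp hq =>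
    simp only [map_add, add_mul, hp, hq, coeff_add, Subalgebra.coe_add]

lemma eS_yPow_phi_merge_eS {J : Finset (Fin n)} (β : J →₀ ℕ)
    (F : MvPolynomial J (supported K (↑Jᶜ : Set (Fin n)))) :
    eS K J * yPow K (extend β) * phi K n (merge K J F) * eS K J =
      phi K n (coeff β F).1 * eS K J := by
  ext1 f
  exact kill_yPow_merge_mul β F (kill_mem_supported J f)

section Prime

variable {R : Type*} [Ring R] {P : TwoSidedIdeal R}

lemma mem_or_mem_of_tsiPrime (hP : tsiPrime P) {a b : R} (h : ∀ r, a * r * b ∈ P) :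
    a ∈ P ∨ b ∈ P := by
  let I : TwoSidedIdeal R := .mk' {x | ∀ r, x * r * b ∈ P}
    (fun r => by simp [P.zero_mem])
    (fun hx hy r => by rw [add_mul, add_mul]; exact P.add_mem (hx r) (hy r))
    (fun hx r => by rw [neg_mul, neg_mul]; exact P.neg_mem (hx r))
    (fun {u x} hx r => by rw [mul_assoc u, mul_assoc u]; exact P.mul_mem_left _ _ (hx r))
    (fun {x u} hx r => by rw [mul_assoc x]; exact hx (u * r))
  have hI : ∀ x, x ∈ I ↔ ∀ r, x * r * b ∈ P := fun x => TwoSidedIdeal.mem_mk' ..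
  let J : TwoSidedIdeal R := .mk' {y | ∀ x ∈ I, x * y ∈ P}
    (fun x _ => by simp [P.zero_mem])
    (fun hx hy r hr => by rw [mul_add]; exact P.add_mem (hx r hr) (hy r hr))
    (fun hx r hr => by rw [mul_neg]; exact P.neg_mem (hx r hr))
    (fun hx r hr => by rw [← mul_assoc]; exact hx _ (I.mul_mem_right _ _ hr))
    (fun hx r hr => by rw [← mul_assoc]; exact P.mul_mem_right _ _ (hx r hr))
  have hJ : ∀ y, y ∈ J ↔ ∀ x ∈ I, x * y ∈ P := fun x => TwoSidedIdeal.mem_mk' ..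
  have hIJ : tsiMul I J ≤ P := by
    refine TwoSidedIdeal.span_le.2 ?_
    rintro _ ⟨x, hx, y, hy, rfl⟩
    exact (hJ y).1 hy x hx
  refine (hP.2 I J hIJ).imp (fun hle => hle ((hI a).2 h)) fun hle => hle ((hJ b).2 fun x hx => ?_)
  simpa using (hI x).1 hx 1

lemma tsiPrime_of_exists (hP : P ≠ ⊤) (h : ∀ a b, a ∉ P → b ∉ P → ∃ r, a * r * b ∉ P) :
    tsiPrime P := by
  refine ⟨hP, fun I J hIJ => ?_⟩
  by_contra! hne
  obtain ⟨a, ha, haP⟩ := SetLike.not_le_iff_exists.1 hne.1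
  obtain ⟨b, hb, hbP⟩ := SetLike.not_le_iff_exists.1 hne.2
  obtain ⟨r, hr⟩ := h a b haP hbP
  exact hr (hIJ (TwoSidedIdeal.subset_span ⟨a * r, I.mul_mem_right _ _ ha, b, hb, rfl⟩))

lemma mem_or_mem_of_central (hP : tsiPrime P) {z b : R} (hz : ∀ r, z * r - r * z ∈ P)
    (h : z * b ∈ P) : z ∈ P ∨ b ∈ P := by
  refine mem_or_mem_of_tsiPrime hP fun r => ?_
  rw [show z * r * b = (z * r - r * z) * b + r * (z * b) by noncomm_ring]
  exact P.add_mem (P.mul_mem_right _ _ (hz r)) (P.mul_mem_left _ _ h)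

lemma central_add {x y : R} (hx : ∀ a, x * a - a * x ∈ P) (hy : ∀ a, y * a - a * y ∈ P) (a : R) :
    (x + y) * a - a * (x + y) ∈ P := by
  rw [show (x + y) * a - a * (x + y) = (x * a - a * x) + (y * a - a * y) by noncomm_ring]
  exact P.add_mem (hx a) (hy a)

lemma central_mul {x y : R} (hx : ∀ a, x * a - a * x ∈ P) (hy : ∀ a, y * a - a * y ∈ P) (a : R) :
    (x * y) * a - a * (x * y) ∈ P := by
  rw [show (x * y) * a - a * (x * y) = x * (y * a - a * y) + (x * a - a * x) * y by noncomm_ring]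
  exact P.add_mem (P.mul_mem_left _ _ (hy a)) (P.mul_mem_right _ _ (hx a))

lemma comm_sub_add {x a b : R} (ha : x * a - a * x ∈ P) (hb : x * b - b * x ∈ P) :
    x * (a + b) - (a + b) * x ∈ P := by
  rw [show x * (a + b) - (a + b) * x = (x * a - a * x) + (x * b - b * x) by noncomm_ring]
  exact P.add_mem ha hb

lemma comm_sub_mul_of_commute {x y a : R} (h : x * y = y * x) (ha : x * a - a * x ∈ P) :
    x * (y * a) - y * a * x ∈ P := by
  rw [show x * (y * a) - y * a * x = y * (x * a - a * x) by
    rw [← mul_assoc, h]; noncomm_ring]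
  exact P.mul_mem_left _ _ ha

lemma comm_sub_mul_of_leftInv {x y a : R} (h : y * x = 1) (he : 1 - x * y ∈ P)
    (ha : x * a - a * x ∈ P) : x * (y * a) - y * a * x ∈ P := by
  rw [show x * (y * a) - y * a * x = y * (x * a - a * x) - (1 - x * y) * a by
    rw [mul_sub, ← mul_assoc y x, h]; noncomm_ring]
  exact P.sub_mem (P.mul_mem_left _ _ ha) (P.mul_mem_right _ _ he)

lemma smul_mem_tsi [Algebra K R] (c : K) {a : R} (ha : a ∈ P) : c • a ∈ P := by
  rw [Algebra.smul_def]
  exact P.mul_mem_left _ _ ha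

lemma sub_self_mem (a : R) : a - a ∈ P := by
  rw [sub_self]
  exact P.zero_mem

lemma smul_sub_smul_mem [Algebra K R] (c : K) {a b : R} (h : a - b ∈ P) : c • a - c • b ∈ P := by
  rw [← smul_sub]
  exact smul_mem_tsi c h

lemma mem_of_sub_mem_of_mem {a b : R} (h : a - b ∈ P) (hb : b ∈ P) : a ∈ P := by
  simpa using P.add_mem h hb

lemma mem_of_mem_of_sub_mem {a b : R} (ha : a ∈ P) (h : a - b ∈ P) : b ∈ P := by
  simpa using P.sub_mem ha h

end Prime

variable {P : TwoSidedIdeal (SnAlg K n)}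

lemma yPow_comm_eS {J : Finset (Fin n)} {j : Fin n} (h : j ∉ J) (k : ℕ) :
    yPow K (Finsupp.single j k) * eS K J = eS K J * yPow K (Finsupp.single j k) := by
  induction k with
  | zero => rw [Finsupp.single_zero, yPow_zero, one_mul, mul_one]
  | succ k ih =>
    rw [Finsupp.single_add, yPow_add, yPow_single, mul_assoc, yS_comm_eS h, ← mul_assoc, ih,
      mul_assoc]

lemma eS_insert_notMem (hP : tsiPrime P) {J : Finset (Fin n)} {j : Fin n} (hj : j ∉ J)
    (h1 : eS K {j} ∉ P) (h2 : eS K J ∉ P) : eS K (insert j J) ∉ P := by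
  intro h
  rw [eS_insert] at h
  have key : ∀ a : SnAlg K n, ∀ k : ℕ,
      eS K {j} * (yPow K (Finsupp.single j k) * (a * eS K J)) ∈ P := by
    intro a
    induction a using left_induction with
    | one =>
      intro k
      rw [one_mul, yPow_comm_eS hj, ← mul_assoc]
      exact P.mul_mem_right _ _ h
    | add a b ha hb =>
      intro k
      rw [add_mul a b, mul_add (yPow K _), mul_add (eS K {j})]
      exact P.add_mem (ha k) (hb k)
    | smul c a ha =>
      intro k
      rw [smul_mul_assoc, mul_smul_comm, mul_smul_comm]
      exact smul_mem_tsi c (ha k)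
    | x_mul i a ha =>
      intro k
      rcases eq_or_ne i j with rfl | hij
      · rcases k with _ | k
        · rw [Finsupp.single_zero, yPow_zero, one_mul, mul_assoc, ← mul_assoc,
            eS_mul_xS_of_mem (Finset.mem_singleton_self i), zero_mul]
          exact P.zero_mem
        · rw [Finsupp.single_add, yPow_add, yPow_single, mul_assoc (xS K n i),
            mul_assoc (yPow K _), ← mul_assoc (yS K n i), yS_mul_xS, one_mul]
          exact ha k
      · rw [mul_assoc (xS K n i), ← mul_assoc (yPow K _),
          ← xS_comm_yPow (Finsupp.single_eq_of_ne hij), mul_assoc (xS K n i),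
          ← mul_assoc (eS K {j}), ← xS_comm_eS (by simpa using hij), mul_assoc]
        exact P.mul_mem_left _ _ (ha k)
    | y_mul i a ha =>
      intro k
      rcases eq_or_ne i j with rfl | hij
      · have := ha (k + 1)
        rwa [Finsupp.single_add, yPow_add, yPow_single, mul_assoc (yPow K _),
          ← mul_assoc (yS K n i)] at this
      · rw [mul_assoc (yS K n i), ← mul_assoc (yPow K _), ← yS_comm_yPow,
          mul_assoc (yS K n i), ← mul_assoc (eS K {j}), ← yS_comm_eS (by simpa using hij),
          mul_assoc]
        exact P.mul_mem_left _ _ (ha k)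
  refine (mem_or_mem_of_tsiPrime hP fun r => ?_).elim h1 h2
  have := key r 0
  rwa [Finsupp.single_zero, yPow_zero, one_mul, ← mul_assoc] at this

open Classical in
/-- The set of indices `j` such that `1 - x_j y_j` does not belong to the ideal `P`. -/
def idx (P : TwoSidedIdeal (SnAlg K n)) : Finset (Fin n) := {j | eS K {j} ∉ P}

lemma mem_idx {j : Fin n} : j ∈ idx P ↔ eS K {j} ∉ P := by simp [idx]

lemma eS_mem_of_notMem_idx {j : Fin n} (h : j ∉ idx P) : eS K {j} ∈ P := by
  simpa [mem_idx] using h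

lemma eS_idx_notMem (hP : tsiPrime P) : eS K (idx P) ∉ P := by
  suffices ∀ J ⊆ idx P, eS K J ∉ P from this _ subset_rfl
  intro J
  induction J using Finset.induction_on with
  | empty =>
    intro _ h
    rw [eS_empty] at h
    exact hP.1 (eq_top_iff.2 fun x _ => by simpa using P.mul_mem_left x _ h)
  | insert j J hj ih =>
    intro hJ
    rw [Finset.insert_subset_iff] at hJ
    exact eS_insert_notMem hP hj (mem_idx.1 hJ.1) (ih hJ.2)

lemma xS_central {i : Fin n} (h : eS K {i} ∈ P) (a : SnAlg K n) :
    xS K n i * a - a * xS K n i ∈ P := by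
  induction a using left_induction with
  | one => rw [mul_one, one_mul]; exact sub_self_mem _
  | add a b ha hb => exact comm_sub_add ha hb
  | smul c a ha =>
    rw [mul_smul_comm, smul_mul_assoc]
    exact smul_sub_smul_mem c ha
  | x_mul j a ha => exact comm_sub_mul_of_commute (xS_comm_xS i j) ha
  | y_mul j a ha =>
    rcases eq_or_ne i j with rfl | hij
    · exact comm_sub_mul_of_leftInv (yS_mul_xS i) (eS_singleton (K := K) i ▸ h) ha
    · exact comm_sub_mul_of_commute (xS_comm_yS hij) ha

lemma phi_central {J : Finset (Fin n)} (hJ : ∀ i ∉ J, eS K {i} ∈ P) {f : PolyAlg K n}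
    (hf : f ∈ supported K (↑Jᶜ : Set (Fin n))) (a : SnAlg K n) :
    phi K n f * a - a * phi K n f ∈ P := by
  rw [supported_eq_adjoin_X] at hf
  induction hf using Algebra.adjoin_induction generalizing a with
  | mem x hx =>
    obtain ⟨i, hi, rfl⟩ := hx
    exact xS_central (hJ i (by simpa using hi)) a
  | algebraMap r =>
    rw [AlgHom.commutes, Algebra.commutes]
    exact sub_self_mem _
  | add x y _ _ hx hy => rw [map_add]; exact central_add hx hy a
  | mul x y _ _ hx hy => rw [map_mul]; exact central_mul hx hy a

/-- The contraction of an ideal of `S_n` to `P_n`. -/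
def contr (P : TwoSidedIdeal (SnAlg K n)) : Ideal (PolyAlg K n) :=
  P.asIdeal.comap (phi K n)

lemma mem_contr {f : PolyAlg K n} : f ∈ contr P ↔ phi K n f ∈ P := Iff.rfl

lemma contr_isPrime (hP : tsiPrime P) : (contr P).IsPrime := by
  set J := idx P with hJ
  have hc : ∀ {f : PolyAlg K n}, f ∈ supported K (↑Jᶜ : Set (Fin n)) → ∀ a,
      phi K n f * a - a * phi K n f ∈ P := phi_central fun i hi => eS_mem_of_notMem_idx hi
  let p := (contr P).comap (merge K J)
  let q := p.comap C
  have hq : ∀ a, a ∈ q ↔ phi K n a.1 ∈ P := fun a => by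
    change merge K J (C a) ∈ contr P ↔ _
    rw [merge_C, mem_contr]
  have hqp : q.IsPrime := by
    refine ⟨fun h => ?_, fun {a b} h => ?_⟩
    · have := (hq 1).1 (h ▸ Submodule.mem_top)
      rw [Subalgebra.coe_one, map_one] at this
      exact hP.1 (eq_top_iff.2 fun x _ => by simpa using P.mul_mem_left x _ this)
    · rw [hq] at h ⊢
      rw [Subalgebra.coe_mul, map_mul] at h
      rw [hq]
      exact mem_or_mem_of_central hP (hc a.2) h
  have hpq : p = q.map C := by
    refine le_antisymm (fun F hF => mem_map_C_iff.2 fun β => (hq _).2 ?_) Ideal.map_comap_le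
    have h1 : phi K n (merge K J F) ∈ P := hF
    have h2 := P.mul_mem_right _ (eS K J) (P.mul_mem_left (eS K J * yPow K (extend β)) _ h1)
    rw [eS_yPow_phi_merge_eS] at h2
    exact (mem_or_mem_of_central hP (hc (coeff β F).2) h2).resolve_right (eS_idx_notMem hP)
  have hpp : p.IsPrime := by
    have := (Ideal.Quotient.isDomain_iff_prime q).2 hqp
    rw [hpq]
    exact (Ideal.Quotient.isDomain_iff_prime (q.map (C : _ →+* MvPolynomial J _))).1
      ((quotientEquivQuotientMvPolynomial (σ := J) q).symm.toMulEquiv.isDomain _)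
  refine ⟨fun h => hpp.ne_top (by simp [p, h]), fun {a b} h => ?_⟩
  obtain ⟨a, rfl⟩ := merge_surjective J a
  obtain ⟨b, rfl⟩ := merge_surjective J b
  rw [← map_mul] at h
  exact hpp.mem_or_mem (x := a) (y := b) h

lemma eS_mul_self (J : Finset (Fin n)) : eS K J * eS K J = eS K J := by
  ext1 f
  exact kill_of_mem_supported (kill_mem_supported J f)

section

variable {R : Type*} [Ring R] {I : TwoSidedIdeal R} {e z w f g : R}

lemma sub_mem_of_add {f' g' : R} (hg : g * g' = g' * g) (h1 : g * z - f * e ∈ I)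
    (h2 : g' * w - f' * e ∈ I) : g * g' * (z + w) - (g' * f + g * f') * e ∈ I := by
  rw [show g * g' * (z + w) - (g' * f + g * f') * e =
      g' * (g * z - f * e) + g * (g' * w - f' * e) by
    rw [mul_add, hg, mul_sub, ← mul_assoc, ← hg]; noncomm_ring]
  exact I.add_mem (I.mul_mem_left _ _ h1) (I.mul_mem_left _ _ h2)

lemma sub_mem_of_mul {x : R} (hg : g * x = x * g) (h : g * z - f * e ∈ I) :
    g * (x * z) - x * f * e ∈ I := by
  rw [← mul_assoc, hg, mul_assoc, mul_assoc, ← mul_sub]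
  exact I.mul_mem_left _ _ h

lemma sub_mem_of_leftInv {x y : R} (hx : 1 - x * y ∈ I) (h : g * z - f * e ∈ I) :
    g * x * (y * z) - f * e ∈ I := by
  rw [show g * x * (y * z) - f * e = (g * z - f * e) - g * ((1 - x * y) * z) by noncomm_ring]
  exact I.sub_mem h (I.mul_mem_left _ _ (I.mul_mem_right _ _ hx))

end

lemma exists_corner {J : Finset (Fin n)} (hJ : ∀ i ∉ J, eS K {i} ∈ P) (b : SnAlg K n) :
    ∀ γ : Fin n →₀ ℕ, (∀ i ∉ J, γ i = 0) →
      ∃ g f : PolyAlg K n, g ∈ supported K (↑Jᶜ : Set (Fin n)) ∧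
        f ∈ supported K (↑Jᶜ : Set (Fin n)) ∧ (∃ u, u * phi K n g = 1) ∧
        phi K n g * (eS K J * (yPow K γ * (b * eS K J))) - phi K n f * eS K J ∈ P := by
  have hzero : ∃ g f : PolyAlg K n, g ∈ supported K (↑Jᶜ : Set (Fin n)) ∧
        f ∈ supported K (↑Jᶜ : Set (Fin n)) ∧
      (∃ u, u * phi K n g = 1) ∧ phi K n g * 0 - phi K n f * eS K J ∈ P :=
    ⟨1, 0, one_mem _, zero_mem _, ⟨1, by rw [map_one, one_mul]⟩, by
      rw [mul_zero, map_zero, zero_mul]; exact sub_self_mem _⟩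
  induction b using left_induction with
  | one =>
    intro γ hγ
    by_cases h : γ = 0
    · refine ⟨1, 1, one_mem _, one_mem _, ⟨1, by rw [map_one, one_mul]⟩, ?_⟩
      rw [h, yPow_zero, map_one, one_mul, one_mul, one_mul, eS_mul_self]
      exact sub_self_mem _
    · have : ∃ j, γ j ≠ 0 := by
        by_contra! h'; exact h (Finsupp.ext h')
      obtain ⟨j, hj⟩ := this
      have hjJ : j ∈ J := by
        by_contra h'; exact hj (hγ j h')
      have : γ = (γ - Finsupp.single j 1) + Finsupp.single j 1 :=
        (tsub_add_cancel_of_le (by simpa [Nat.one_le_iff_ne_zero] using hj)).symm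
      rw [this, yPow_add, yPow_single, one_mul, mul_assoc (yPow K _), yS_mul_eS_of_mem hjJ,
        mul_zero, mul_zero]
      exact hzero
  | add a b ha hb =>
    intro γ hγ
    obtain ⟨g, f, hg, hf, ⟨u, hu⟩, h1⟩ := ha γ hγ
    obtain ⟨g', f', hg', hf', ⟨u', hu'⟩, h2⟩ := hb γ hγ
    refine ⟨g * g', g' * f + g * f', mul_mem hg hg',
      add_mem (mul_mem hg' hf) (mul_mem hg hf'),
      ⟨u' * u, ?_⟩, ?_⟩
    · rw [map_mul, mul_assoc u', ← mul_assoc u, hu, one_mul, hu']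
    · rw [add_mul a b, mul_add (yPow K _), mul_add (eS K J), map_mul, map_add, map_mul, map_mul]
      exact sub_mem_of_add (by rw [← map_mul, mul_comm, map_mul]) h1 h2
  | smul c a ha =>
    intro γ hγ
    obtain ⟨g, f, hg, hf, hu, h1⟩ := ha γ hγ
    refine ⟨g, c • f, hg, Subalgebra.smul_mem _ hf c, hu, ?_⟩
    rw [smul_mul_assoc, mul_smul_comm, mul_smul_comm, mul_smul_comm, map_smul, smul_mul_assoc]
    exact smul_sub_smul_mem c h1
  | x_mul i a ha =>
    intro γ hγ
    by_cases hi : i ∈ J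
    · by_cases h0 : γ i = 0
      · rw [mul_assoc (xS K n i), ← mul_assoc (yPow K _), ← xS_comm_yPow h0,
          mul_assoc (xS K n i), ← mul_assoc (eS K J), eS_mul_xS_of_mem hi, zero_mul]
        exact hzero
      · rw [mul_assoc (xS K n i), ← mul_assoc (yPow K _), yPow_mul_xS h0]
        exact ha _ fun k hk => by simp [hγ k hk]
    · obtain ⟨g, f, hg, hf, hu, h1⟩ := ha γ hγ
      refine ⟨g, X i * f, hg, mul_mem (X_mem_supported.2 (by simpa using hi)) hf, hu, ?_⟩
      rw [mul_assoc (xS K n i), ← mul_assoc (yPow K _), ← xS_comm_yPow (hγ i hi),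
        mul_assoc (xS K n i), ← mul_assoc (eS K J), ← xS_comm_eS hi, mul_assoc (xS K n i),
        map_mul, phi_X]
      exact sub_mem_of_mul (by rw [← phi_X, ← map_mul, mul_comm, map_mul]) h1
  | y_mul i a ha =>
    intro γ hγ
    by_cases hi : i ∈ J
    · have := ha (γ + Finsupp.single i 1) fun k hk => by
        rw [Finsupp.add_apply, hγ k hk, zero_add, Finsupp.single_apply, if_neg]
        rintro rfl
        exact hk hi
      rwa [yPow_add, yPow_single, mul_assoc (yPow K _), ← mul_assoc (yS K n i)] at this
    · obtain ⟨g, f, hg, hf, ⟨u, hu⟩, h1⟩ := ha γ hγ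
      refine ⟨g * X i, f, mul_mem hg (X_mem_supported.2 (by simpa using hi)), hf,
         ⟨yS K n i * u, ?_⟩, ?_⟩
      · rw [map_mul, phi_X, mul_assoc (yS K n i), ← mul_assoc u, hu, one_mul, yS_mul_xS]
      · rw [mul_assoc (yS K n i), ← mul_assoc (yPow K _), ← yS_comm_yPow,
          mul_assoc (yS K n i), ← mul_assoc (eS K J), ← yS_comm_eS hi, mul_assoc (yS K n i),
          map_mul, phi_X]
        exact sub_mem_of_leftInv (eS_singleton (K := K) i ▸ hJ i hi) h1

lemma le_of_contr_le {Q : TwoSidedIdeal (SnAlg K n)} (hP : tsiPrime P) (hQ : tsiPrime Q)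
    (hle : P ≤ Q) (hidx : idx P = idx Q) (hc : contr Q ≤ contr P) : Q ≤ P := by
  have hJ : ∀ i ∉ idx P, eS K {i} ∈ P := fun i hi => eS_mem_of_notMem_idx hi
  have key : ∀ b ∈ Q, eS K (idx P) * b * eS K (idx P) ∈ P := by
    intro b hb
    obtain ⟨g, f, -, hf, ⟨u, hu⟩, h⟩ := exists_corner hJ b 0 fun _ _ => rfl
    rw [yPow_zero, one_mul] at h
    have hz : eS K (idx P) * (b * eS K (idx P)) ∈ Q :=
      Q.mul_mem_left _ _ (Q.mul_mem_right _ _ hb)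
    have h1 : phi K n f * eS K (idx P) ∈ Q := 
      mem_of_mem_of_sub_mem (Q.mul_mem_left (phi K n g) _ hz) (hle h)
    have h2 : phi K n f ∈ Q := (mem_or_mem_of_central hQ
      (fun r => hle (phi_central hJ hf r)) h1).resolve_right (hidx ▸ eS_idx_notMem hQ)
    have h3 : phi K n f ∈ P := hc h2
    have h4 := P.mul_mem_left u _ (mem_of_sub_mem_of_mem h (P.mul_mem_right _ (eS K (idx P)) h3))
    rwa [← mul_assoc, hu, one_mul, ← mul_assoc] at h4
  intro c hcQ
  have h1 : ∀ r, eS K (idx P) * r * c ∈ P := fun r =>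
    (mem_or_mem_of_tsiPrime hP fun s => by
      have := key (r * c * s) (Q.mul_mem_right _ _ (Q.mul_mem_left _ _ hcQ))
      simpa only [mul_assoc] using this).resolve_right (eS_idx_notMem hP)
  exact (mem_or_mem_of_tsiPrime hP h1).resolve_left (eS_idx_notMem hP)

lemma idx_anti {Q : TwoSidedIdeal (SnAlg K n)} (h : P ≤ Q) : idx Q ⊆ idx P := fun _ hj =>
  mem_idx.2 fun hP => mem_idx.1 hj (h hP)

lemma contr_mono {Q : TwoSidedIdeal (SnAlg K n)} (h : P ≤ Q) : contr P ≤ contr Q :=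
  fun _ hf => h hf

lemma height_primeSpectrum_le (p : PrimeSpectrum (PolyAlg K n)) : Order.height p ≤ n := by
  have h1 : (Order.height p : WithBot ℕ∞) ≤ ringKrullDim (PolyAlg K n) := Order.height_le_krullDim p
  rw [MvPolynomial.ringKrullDim_of_isNoetherianRing, ringKrullDim_eq_zero_of_field, zero_add,
    Nat.card_eq_fintype_card, Fintype.card_fin] at h1
  exact_mod_cast h1

theorem length_le_of_strictMono {m : ℕ} {f : Fin (m + 1) → TwoSidedIdeal (SnAlg K n)}
    (hf : StrictMono f) (hp : ∀ i, tsiPrime (f i)) : m ≤ 2 * n := by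
  let c (i : Fin (m + 1)) : PrimeSpectrum (PolyAlg K n) := ⟨contr (f i), contr_isPrime (hp i)⟩
  let v (i : Fin (m + 1)) : ℕ := (n - (idx (f i)).card) + (Order.height (c i)).toNat
  have hfin (i) : Order.height (c i) ≠ ⊤ :=
    ((height_primeSpectrum_le (c i)).trans_lt (ENat.natCast_lt_top n)).ne
  have hcard (i) : (idx (f i)).card ≤ n := (idx (f i)).card_le_univ.trans_eq (Fintype.card_fin n)
  have hv : StrictMono v := by
    intro i j hij
    have hlt := hf hij
    have hc : c i ≤ c j := contr_mono hlt.le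
    have h2 : (Order.height (c i)).toNat ≤ (Order.height (c j)).toNat :=
      ENat.toNat_le_toNat (Order.height_mono hc) (hfin j)
    have h1 := hcard i
    rcases (idx_anti hlt.le).eq_or_ssubset with he | hs
    · have hcc : c i < c j := by
        refine lt_of_le_not_ge hc fun hle => hlt.not_ge ?_
        exact le_of_contr_le (hp i) (hp j) hlt.le he.symm hle
      have h3 : (Order.height (c i)).toNat < (Order.height (c j)).toNat := by
        have := Order.height_strictMono hcc (hfin i).lt_top
        rw [← ENat.natCast_toNat (hfin i), ← ENat.natCast_toNat (hfin j)] at this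
        exact_mod_cast this
      simp only [v, he]
      omega
    · have := Finset.card_lt_card hs
      simp only [v]
      omega
  have hle : ∀ i : Fin (m + 1), (i : ℕ) ≤ v i := fun i => by
    induction i using Fin.induction with
    | zero => exact Nat.zero_le _
    | succ i ih => exact Nat.succ_le_of_lt (ih.trans_lt (hv i.castSucc_lt_succ))
  have h1 : m ≤ v (Fin.last m) := hle (Fin.last m)
  have h2 : (Order.height (c (Fin.last m))).toNat ≤ n := by
    have := height_primeSpectrum_le (c (Fin.last m))
    rw [← ENat.natCast_toNat (hfin _)] at this
    exact_mod_cast this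
  simp only [v] at h1
  omega

/-- The substitution `x_i ↦ 1` for `i ∈ I`. -/
def spec (K : Type*) [Field K] {n : ℕ} (I : Finset (Fin n)) : PolyAlg K n →ₐ[K] PolyAlg K n :=
  aeval fun i => if i ∈ I then 1 else X i

lemma spec_X_of_mem {I : Finset (Fin n)} {i : Fin n} (h : i ∈ I) : spec K I (X i) = 1 := by
  simp [spec, h]

lemma spec_X_of_notMem {I : Finset (Fin n)} {i : Fin n} (h : i ∉ I) :
    spec K I (X i) = X i := by
  simp [spec, h]

lemma spec_spec {I I' : Finset (Fin n)} (h : I ⊆ I') (f : PolyAlg K n) :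
    spec K I' (spec K I f) = spec K I' f := by
  rw [← AlgHom.comp_apply]
  congr 1
  ext1 i
  by_cases hi : i ∈ I
  · simp [spec_X_of_mem hi, spec_X_of_mem (h hi)]
  · simp [spec_X_of_notMem hi]

lemma spec_mem_supported (I : Finset (Fin n)) {s : Set (Fin n)} {f : PolyAlg K n}
    (hf : f ∈ supported K s) : spec K I f ∈ supported K s := by
  rw [supported_eq_adjoin_X] at hf
  induction hf using Algebra.adjoin_induction with
  | mem x hx =>
    obtain ⟨i, hi, rfl⟩ := hx
    by_cases h : i ∈ I
    · rw [spec_X_of_mem h]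
      exact one_mem _
    · rw [spec_X_of_notMem h]
      exact X_mem_supported.2 hi
  | algebraMap r => rw [AlgHom.commutes]; exact Subalgebra.algebraMap_mem _ _
  | add x y _ _ hx hy => rw [map_add]; exact add_mem hx hy
  | mul x y _ _ hx hy => rw [map_mul]; exact mul_mem hx hy

lemma spec_yS_eq_zero {I : Finset (Fin n)} {i : Fin n} (hi : i ∉ I) {f : PolyAlg K n}
    (hf : spec K I f = 0) : spec K I ((yS K n i).1 f) = 0 := by
  have h1 : spec K I (kill K {i} f) + X i * spec K I ((yS K n i).1 f) = 0 := by
    rw [kill_singleton_eq, map_sub, map_mul, spec_X_of_notMem hi, hf]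
    ring
  have h2 := congrArg (yS K n i).1 h1
  rwa [map_add, yS_X_mul, map_zero, yS_eq_zero_of_mem_supported _
    (spec_mem_supported I (kill_mem_supported {i} f)), zero_add] at h2
  simp

/-- The product of the variables `x_i`, `i ∈ I`. -/
def mon (K : Type*) [Field K] {n : ℕ} (I : Finset (Fin n)) : PolyAlg K n := ∏ i ∈ I, X i

lemma X_dvd_mon {I : Finset (Fin n)} {i : Fin n} (h : i ∈ I) : X i ∣ mon K I :=
  Finset.dvd_prod_of_mem _ h

lemma mon_dvd_mon {I J : Finset (Fin n)} (h : I ⊆ J) : mon K I ∣ mon K J :=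
  Finset.prod_dvd_prod_of_subset _ _ _ h

lemma mon_pow_mem_supported (I : Finset (Fin n)) (N : ℕ) :
    mon K I ^ N ∈ supported K (I : Set (Fin n)) :=
  Subalgebra.pow_mem _ (Subalgebra.prod_mem _ fun _ hi => X_mem_supported.2 hi) N

lemma spec_mon_pow_ne_zero (I I' : Finset (Fin n)) (N : ℕ) : spec K I' (mon K I ^ N) ≠ 0 := by
  rw [map_pow, mon, map_prod]
  refine pow_ne_zero N (Finset.prod_ne_zero_iff.2 fun i _ => ?_)
  by_cases h : i ∈ I'
  · rw [spec_X_of_mem h]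
    exact one_ne_zero
  · rw [spec_X_of_notMem h]
    exact X_ne_zero i

lemma mon_pow_dvd_yS (I : Finset (Fin n)) (i : Fin n) {N : ℕ} {f : PolyAlg K n}
    (h : mon K I ^ (N + 1) ∣ f) : mon K I ^ N ∣ (yS K n i).1 f := by
  obtain ⟨u, rfl⟩ := h
  by_cases hi : i ∈ I
  · obtain ⟨v, hv⟩ := X_dvd_mon (K := K) hi
    refine ⟨v * u, ?_⟩
    rw [pow_succ, show mon K I ^ N * mon K I * u = X i * (mon K I ^ N * (v * u)) by
      linear_combination mon K I ^ N * u * hv, yS_X_mul]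
  · rw [pow_succ, mul_assoc, yS_mul_of_mem_supported (by simpa using hi)
      (mon_pow_mem_supported I N)]
    exact dvd_mul_right _ _

lemma exists_mon_pow_dvd (I : Finset (Fin n)) (b : SnAlg K n) (M : ℕ) :
    ∃ N, ∀ f, mon K I ^ N ∣ f → mon K I ^ M ∣ b.1 f := by
  induction b using left_induction generalizing M with
  | one => exact ⟨M, fun f hf => hf⟩
  | add a b ha hb =>
    obtain ⟨N, hN⟩ := ha M
    obtain ⟨N', hN'⟩ := hb M
    exact ⟨N + N', fun f hf => dvd_add (hN f (dvd_trans (pow_dvd_pow _ (by omega)) hf))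
      (hN' f (dvd_trans (pow_dvd_pow _ (by omega)) hf))⟩
  | smul c a ha =>
    obtain ⟨N, hN⟩ := ha M
    refine ⟨N, fun f hf => ?_⟩
    change _ ∣ c • a.1 f
    rw [smul_eq_C_mul]
    exact (hN f hf).mul_left _
  | x_mul i a ha =>
    obtain ⟨N, hN⟩ := ha M
    exact ⟨N, fun f hf => (hN f hf).mul_left _⟩
  | y_mul i a ha =>
    obtain ⟨N, hN⟩ := ha (M + 1)
    exact ⟨N, fun f hf => mon_pow_dvd_yS I i (hN f hf)⟩

lemma exists_spec_eq_zero {I I' : Finset (Fin n)} (hI : I' ⊆ I) (b : SnAlg K n) :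
    ∃ N, ∀ f, mon K I ^ N ∣ f → spec K I' f = 0 → spec K I' (b.1 f) = 0 := by
  induction b using left_induction with
  | one => exact ⟨0, fun f _ hf => hf⟩
  | add a b ha hb =>
    obtain ⟨N, hN⟩ := ha
    obtain ⟨N', hN'⟩ := hb
    refine ⟨N + N', fun f hf h0 => ?_⟩
    rw [add_apply, map_add, hN f (dvd_trans (pow_dvd_pow _ (by omega)) hf) h0,
      hN' f (dvd_trans (pow_dvd_pow _ (by omega)) hf) h0, add_zero]
  | smul c a ha =>
    obtain ⟨N, hN⟩ := ha
    refine ⟨N, fun f hf h0 => ?_⟩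
    change spec K I' (c • a.1 f) = 0
    rw [map_smul, hN f hf h0, smul_zero]
  | x_mul i a ha =>
    obtain ⟨N, hN⟩ := ha
    refine ⟨N, fun f hf h0 => ?_⟩
    rw [mul_apply, xS_apply, map_mul, hN f hf h0, mul_zero]
  | y_mul i a ha =>
    obtain ⟨N, hN⟩ := ha
    obtain ⟨N', hN'⟩ := exists_mon_pow_dvd I a 1
    refine ⟨N + N', fun f hf h0 => ?_⟩
    have h1 := hN f (dvd_trans (pow_dvd_pow _ (by omega)) hf) h0
    rw [mul_apply]
    by_cases hi : i ∈ I'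
    · have h2 := hN' f (dvd_trans (pow_dvd_pow _ (by omega)) hf)
      rw [pow_one] at h2
      obtain ⟨u, hu⟩ := (X_dvd_mon (hI hi)).trans h2
      rw [hu, map_mul, spec_X_of_mem hi, one_mul] at h1
      rw [hu, yS_X_mul, h1]
    · exact spec_yS_eq_zero hi h1

lemma exists_mul_comm (I : Finset (Fin n)) (b : SnAlg K n) :
    ∃ N, ∀ h ∈ supported K (I : Set (Fin n)), ∀ f, mon K I ^ N ∣ f →
      b.1 (h * f) = h * b.1 f := by
  induction b using left_induction with
  | one => exact ⟨0, fun h _ f _ => rfl⟩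
  | add a b ha hb =>
    obtain ⟨N, hN⟩ := ha
    obtain ⟨N', hN'⟩ := hb
    refine ⟨N + N', fun h hh f hf => ?_⟩
    rw [add_apply, add_apply, hN h hh f (dvd_trans (pow_dvd_pow _ (by omega)) hf),
      hN' h hh f (dvd_trans (pow_dvd_pow _ (by omega)) hf), mul_add]
  | smul c a ha =>
    obtain ⟨N, hN⟩ := ha
    refine ⟨N, fun h hh f hf => ?_⟩
    change c • a.1 (h * f) = h * (c • a.1 f)
    rw [hN h hh f hf, mul_smul_comm]
  | x_mul i a ha =>
    obtain ⟨N, hN⟩ := ha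
    refine ⟨N, fun h hh f hf => ?_⟩
    rw [mul_apply, mul_apply, xS_apply, xS_apply, hN h hh f hf, mul_left_comm]
  | y_mul i a ha =>
    obtain ⟨N, hN⟩ := ha
    obtain ⟨N', hN'⟩ := exists_mon_pow_dvd I a 1
    refine ⟨N + N', fun h hh f hf => ?_⟩
    rw [mul_apply, mul_apply, hN h hh f (dvd_trans (pow_dvd_pow _ (by omega)) hf)]
    by_cases hi : i ∈ I
    · have h2 := hN' f (dvd_trans (pow_dvd_pow _ (by omega)) hf)
      rw [pow_one] at h2
      obtain ⟨u, hu⟩ := (X_dvd_mon hi).trans h2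
      rw [hu, mul_left_comm, yS_X_mul, yS_X_mul]
    · exact yS_mul_of_mem_supported (by simpa using hi) hh _

/-- For `I' ⊆ I`, the ideal of all `c` such that `c f` vanishes after the substitution `x_i ↦ 1`,
`i ∈ I'`, for all `f` divisible by a sufficiently high power of `∏ i ∈ I, x_i`. -/
def locIdeal (K : Type*) [Field K] {n : ℕ} {I I' : Finset (Fin n)} (hI : I' ⊆ I) :
    TwoSidedIdeal (SnAlg K n) :=
  .mk' {c | ∃ N, ∀ f, mon K I ^ N ∣ f → spec K I' (c.1 f) = 0}
    ⟨0, fun f _ => by rw [zero_apply, map_zero]⟩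
    (fun {a b} ⟨N, ha⟩ ⟨N', hb⟩ => ⟨N + N', fun f hf => by
      rw [add_apply, map_add, ha f (dvd_trans (pow_dvd_pow _ (by omega)) hf),
        hb f (dvd_trans (pow_dvd_pow _ (by omega)) hf), add_zero]⟩)
    (fun {a} ⟨N, ha⟩ => ⟨N, fun f hf => by
      change spec K I' (-(a.1 f)) = 0
      rw [map_neg, ha f hf, neg_zero]⟩)
    (fun {a b} ⟨N, hb⟩ => by
      obtain ⟨M, hM⟩ := exists_spec_eq_zero hI a
      obtain ⟨N', hN'⟩ := exists_mon_pow_dvd I b M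
      exact ⟨N + N', fun f hf => hM _ (hN' f (dvd_trans (pow_dvd_pow _ (by omega)) hf))
        (hb f (dvd_trans (pow_dvd_pow _ (by omega)) hf))⟩)
    (fun {a b} ⟨N, ha⟩ => by
      obtain ⟨N', hN'⟩ := exists_mon_pow_dvd I b N
      exact ⟨N', fun f hf => ha _ (hN' f hf)⟩)

lemma mem_locIdeal {I I' : Finset (Fin n)} {hI : I' ⊆ I} {c : SnAlg K n} :
    c ∈ locIdeal K hI ↔ ∃ N, ∀ f, mon K I ^ N ∣ f → spec K I' (c.1 f) = 0 :=
  TwoSidedIdeal.mem_mk' ..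

lemma exists_of_notMem_locIdeal {I I' : Finset (Fin n)} {hI : I' ⊆ I} {c : SnAlg K n}
    (hc : c ∉ locIdeal K hI) (N : ℕ) : ∃ f, mon K I ^ N ∣ f ∧ spec K I' (c.1 f) ≠ 0 := by
  by_contra! h
  exact hc (mem_locIdeal.2 ⟨N, h⟩)

lemma exists_spec_coeff_ne_zero {J I' : Finset (Fin n)}
    {F : MvPolynomial J (supported K (↑Jᶜ : Set (Fin n)))} (hF : spec K I' (merge K J F) ≠ 0) :
    ∃ β, spec K I' (coeff β F).1 ≠ 0 := by
  by_contra! h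
  refine hF ?_
  rw [F.as_sum, map_sum, map_sum]
  exact Finset.sum_eq_zero fun β _ => by rw [merge_monomial, map_mul, h, zero_mul]

lemma locIdeal_isPrime {I I' : Finset (Fin n)} (hI : I' ⊆ I) : tsiPrime (locIdeal K hI) := by
  refine tsiPrime_of_exists (fun h => ?_) fun a b ha hb => ?_
  · obtain ⟨N, hN⟩ := mem_locIdeal.1 (h ▸ TwoSidedIdeal.mem_top (x := (1 : SnAlg K n)))
    exact spec_mon_pow_ne_zero I I' N (hN _ dvd_rfl)
  obtain ⟨Na, hNa⟩ := exists_mul_comm I a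
  obtain ⟨Nb, hNb⟩ := exists_mul_comm I b
  obtain ⟨g, hg, hag⟩ := exists_of_notMem_locIdeal ha Na
  obtain ⟨f, hf, hbf⟩ := exists_of_notMem_locIdeal hb Nb
  have hIc : (↑(Iᶜ)ᶜ : Set (Fin n)) = I := by simp
  obtain ⟨F, hF⟩ := merge_surjective Iᶜ (b.1 f)
  obtain ⟨β, hβ⟩ := exists_spec_coeff_ne_zero (hF ▸ hbf)
  have hβI : (coeff β F).1 ∈ supported K (I : Set (Fin n)) := hIc ▸ (coeff β F).2
  refine ⟨phi K n g * (eS K Iᶜ * yPow K (extend β)), fun h => ?_⟩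
  obtain ⟨N, hN⟩ := mem_locIdeal.1 h
  have hm := mon_pow_mem_supported (K := K) I N
  have h1 := hN (mon K I ^ N * f) (dvd_mul_right _ _)
  simp only [mul_apply, phi_apply, eS_apply] at h1
  rw [hNb _ hm f hf, ← hF, mul_comm (mon K I ^ N), kill_yPow_merge_mul β F (hIc ▸ hm), mul_comm g,
    hNa _ (mul_mem hβI hm) g hg, map_mul, map_mul] at h1
  exact mul_ne_zero (mul_ne_zero hβ (spec_mon_pow_ne_zero I I' N)) hag h1

lemma locIdeal_mono {I₁ I₁' I₂ I₂' : Finset (Fin n)} {h₁ : I₁' ⊆ I₁} {h₂ : I₂' ⊆ I₂}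
    (h : I₁ ⊆ I₂) (h' : I₁' ⊆ I₂') : locIdeal K h₁ ≤ locIdeal K h₂ := by
  intro c hc
  obtain ⟨N, hN⟩ := mem_locIdeal.1 hc
  refine mem_locIdeal.2 ⟨N, fun f hf => ?_⟩
  rw [← spec_spec h', hN f ((pow_dvd_pow_of_dvd (mon_dvd_mon h) N).trans hf), map_zero]

lemma eS_mem_locIdeal {I I' : Finset (Fin n)} {hI : I' ⊆ I} {i : Fin n} :
    eS K {i} ∈ locIdeal K hI ↔ i ∈ I := by
  rw [mem_locIdeal]
  constructor
  · rintro ⟨N, hN⟩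
    by_contra hi
    refine spec_mon_pow_ne_zero (K := K) I I' N ?_
    have h1 := hN _ dvd_rfl
    rwa [eS_apply, kill_of_mem_supported] at h1
    exact supported_mono (by simpa using hi) (mon_pow_mem_supported I N)
  · refine fun hi => ⟨1, fun f hf => ?_⟩
    rw [pow_one] at hf
    obtain ⟨u, rfl⟩ := (X_dvd_mon (K := K) hi).trans hf
    rw [eS_apply, map_mul, kill_X_of_mem (Finset.mem_singleton_self i), zero_mul, map_zero]

lemma xS_sub_one_mem_locIdeal {I I' : Finset (Fin n)} {hI : I' ⊆ I} {i : Fin n} :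
    xS K n i - 1 ∈ locIdeal K hI ↔ i ∈ I' := by
  have key : ∀ f, spec K I' ((xS K n i - 1).1 f) = (spec K I' (X i) - 1) * spec K I' f := by
    intro f
    rw [sub_apply, xS_apply, one_apply, map_sub, map_mul, sub_mul, one_mul]
  simp only [mem_locIdeal, key]
  constructor
  · rintro ⟨N, hN⟩
    by_contra hi
    have h1 := (mul_eq_zero.1 (hN _ dvd_rfl)).resolve_right (spec_mon_pow_ne_zero I I' N)
    rw [spec_X_of_notMem hi, sub_eq_zero] at h1
    simpa using congrArg constantCoeff h1
  · refine fun hi => ⟨0, fun f _ => ?_⟩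
    rw [spec_X_of_mem hi, sub_self, zero_mul]

theorem exists_strictMono_tsiPrime (K : Type*) [Field K] (n : ℕ) :
    ∃ f : Fin (2 * n + 1) → TwoSidedIdeal (SnAlg K n), StrictMono f ∧ ∀ i, tsiPrime (f i) := by
  let I (k : ℕ) : Finset (Fin n) := {i | 2 * (i : ℕ) < k}
  let I' (k : ℕ) : Finset (Fin n) := {i | 2 * (i : ℕ) + 1 < k}
  have hI (k : ℕ) : I' k ⊆ I k := fun i hi => by
    simp only [I, I', Finset.mem_filter_univ] at hi ⊢
    omega
  refine ⟨fun k => locIdeal K (hI k), Fin.strictMono_iff_lt_succ.2 fun k => ?_,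
    fun k => locIdeal_isPrime _⟩
  refine lt_of_le_not_ge (locIdeal_mono (fun i hi => ?_) fun i hi => ?_) fun h => ?_
  · simp only [I, Finset.mem_filter_univ, Fin.val_castSucc, Fin.val_succ] at hi ⊢
    omega
  · simp only [I', Finset.mem_filter_univ, Fin.val_castSucc, Fin.val_succ] at hi ⊢
    omega
  · have hk := k.2
    rcases Nat.even_or_odd' (k : ℕ) with ⟨j, hj | hj⟩
    · have := eS_mem_locIdeal.1 (h (eS_mem_locIdeal (i := ⟨j, by omega⟩).2
        (by simp [I, hj])))
      simp [I, hj] at this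
    · have := xS_sub_one_mem_locIdeal.1 (h (xS_sub_one_mem_locIdeal (i := ⟨j, by omega⟩).2
        (by simp [I', hj])))
      simp [I', hj] at this

end SnAlg

/-- the classical Krull dimension of `S_n` is `2n`: there is a chain of prime
two-sided ideals of length `2n`, and every chain of prime two-sided ideals has length at
most `2n`. -/
theorem statement6 (K : Type u) [Field K] (n : ℕ) (hn : 0 < n) :
    (∃ f : Fin (2 * n + 1) → TwoSidedIdeal (SnAlg K n),
      StrictMono f ∧ ∀ i, tsiPrime (f i)) ∧
    (∀ (m : ℕ) (f : Fin (m + 1) → TwoSidedIdeal (SnAlg K n)),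
      StrictMono f → (∀ i, tsiPrime (f i)) → m ≤ 2 * n) := by
  exact ⟨SnAlg.exists_strictMono_tsiPrime K n, fun _ _ => SnAlg.length_le_of_strictMono⟩
end
end
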